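/- The simulation characterization also holds over infinite trees: for every CTP node formula φ, every possibly infinite tree T, and every node n of T, T,n⊨φ if and only if there exists a simulation from ct(φ) into (T.n, n); and for every CTP path formula α and nodes n,n', (n,n')∈⟦α⟧_T if and only if there exists a simulation from ct(α) into (T.n, n) mapping the output node of ct(α) to n'. -/

import Mathlib

/- Trees over a label alphabet -/
structure RTree (A : Type) where
  Node : Type
  E : Node → Node → Prop
  root : Node
  label : Node → Set A

namespace RTree
variable {A : Type}

/-- Tree axioms not requiring finiteness of the node set: finite label sets,
    connectedness from the root, unique parents, acyclicity. -/
def IsPreTree (T : RTree A) : Prop :=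
  (∀ n, (T.label n).Finite) ∧
  (∀ n, Relation.ReflTransGen T.E T.root n) ∧
  (∀ n m m', T.E m n → T.E m' n → m = m') ∧
  (∀ n, ¬ Relation.TransGen T.E n n)

/-- A (finite, rooted, unranked) tree. -/
def IsTree (T : RTree A) : Prop := T.IsPreTree ∧ Finite T.Node

/-- Single-labeled (XML) trees: every node carries exactly one label. -/
def SingleLabeled (T : RTree A) : Prop := ∀ n, ∃ p, T.label n = {p}

end RTree

/- Conditional Tree Patterns: node formulas and path formulas.
   `cstar φ` is the conditional descendant path (↓;?φ)*;↓. -/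
mutual
inductive CNF (A : Type) : Type where
  | lab : A → CNF A
  | top : CNF A
  | and : CNF A → CNF A → CNF A
  | dia : CPF A → CNF A → CNF A
inductive CPF (A : Type) : Type where
  | child : CPF A
  | test : CNF A → CPF A
  | comp : CPF A → CPF A → CPF A
  | cstar : CNF A → CPF A
end

variable {A : Type}

mutual
/-- Satisfaction of CTP node formulas: the set of nodes where the formula holds. -/
def CNF.sat (T : RTree A) : CNF A → Set T.Node
  | .lab p => {n | p ∈ T.label n}
  | .top => Set.univ
  | .and φ ψ => {n | n ∈ CNF.sat T φ ∧ n ∈ CNF.sat T ψ}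
  | .dia α φ => {n | ∃ m, CPF.sem T α n m ∧ m ∈ CNF.sat T φ}
/-- Semantics of CTP path formulas: ⟦(↓;?φ)*;↓⟧ = (E∘⟦?φ⟧)*∘E. -/
def CPF.sem (T : RTree A) : CPF A → T.Node → T.Node → Prop
  | .child => T.E
  | .test φ => fun n m => n = m ∧ n ∈ CNF.sat T φ
  | .comp α β => fun n m => ∃ k, CPF.sem T α n k ∧ CPF.sem T β k m
  | .cstar φ => fun n m =>
      ∃ k, Relation.ReflTransGen (fun a b => T.E a b ∧ b ∈ CNF.sat T φ) n k ∧ T.E k m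
end

/-- The subtree of `T` rooted at `n`. -/
def RTree.subtree (T : RTree A) (n : T.Node) : RTree A where
  Node := {m : T.Node // Relation.ReflTransGen T.E n m}
  E a b := T.E a.1 b.1
  root := ⟨n, Relation.ReflTransGen.refl⟩
  label m := T.label m.1

/-- Boolean conditional tree patterns: a finite tree whose nodes carry a set of
labels, and whose edges carry either `none` (a child edge ↓) or `some t` with
`t` a Boolean conditional tree pattern (a conditional descendant edge).  The
sole output node of a Boolean pattern is its root. -/
inductive BPat (A : Type) : Type where
  | mk : Set A → List (Option (BPat A) × BPat A) → BPat A

/-- Conditional tree patterns with one output node: a Boolean pattern together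
with a marked path from the root to the output node (the spine).  `here s ch`
is a pattern whose output node is its root; `step s ch el rest` is a pattern
whose root has label set `s`, side subtrees `ch`, and one more edge labeled
`el` towards the subpattern `rest` containing the output node. -/
inductive OPat (A : Type) : Type where
  | here : Set A → List (Option (BPat A) × BPat A) → OPat A
  | step : Set A → List (Option (BPat A) × BPat A) → Option (BPat A) → OPat A → OPat A

mutual
/-- There exists a simulation from the Boolean pattern into the pointed tree
`(T, n)`: the root is mapped to `n`, labels are preserved, child edges are
mapped to child edges, and a conditional edge labeled by a Boolean pattern `c`
is mapped to a descendant edge all of whose intermediate nodes `z` admit a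
simulation of `c` into the subtree `T.z`. -/
def SimB (T : RTree A) (p : BPat A) (n : T.Node) : Prop :=
  match p with
  | .mk s ch => s ⊆ T.label n ∧ SimL T ch n
/-- Simulations for a list of outgoing (labeled) edges of a pattern node. -/
def SimL (T : RTree A) (l : List (Option (BPat A) × BPat A)) (n : T.Node) : Prop :=
  match l with
  | [] => True
  | (none, t) :: r => (∃ m, T.E n m ∧ SimB T t m) ∧ SimL T r n
  | (some c, t) :: r =>
      (∃ m, Relation.TransGen T.E n m ∧ SimB T t m ∧
        ∀ z, Relation.TransGen T.E n z → Relation.TransGen T.E z m →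
          SimB (T.subtree z) c (T.subtree z).root) ∧ SimL T r n
end

mutual
/-- There exists a simulation from the one-output pattern into the pointed tree
`(T, n)` mapping the output node to `out`. -/
def SimO (T : RTree A) (p : OPat A) (n out : T.Node) : Prop :=
  match p with
  | .here s ch => out = n ∧ s ⊆ T.label n ∧ SimL T ch n
  | .step s ch el rest =>
      s ⊆ T.label n ∧ SimL T ch n ∧
      match el with
      | none => ∃ m, T.E n m ∧ SimO T rest m out
      | some c =>
          ∃ m, Relation.TransGen T.E n m ∧ SimO T rest m out ∧
            ∀ z, Relation.TransGen T.E n z → Relation.TransGen T.E z m →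
              SimB (T.subtree z) c (T.subtree z).root
end

/-- Fusion of two Boolean patterns at the root. -/
def BPat.fuse : BPat A → BPat A → BPat A
  | .mk s ch, .mk s' ch' => .mk (s ∪ s') (ch ++ ch')

/-- Fuse a Boolean pattern onto the output node of a one-output pattern,
forgetting the output marking (the result is a Boolean pattern). -/
def OPat.graft : OPat A → BPat A → BPat A
  | .here s ch, .mk s' ch' => .mk (s ∪ s') (ch ++ ch')
  | .step s ch el rest, b => .mk s (ch ++ [(el, OPat.graft rest b)])

/-- Composition of one-output patterns: fuse the root of the second onto the
output node of the first; the output node of the second becomes the output. -/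
def OPat.comp : OPat A → OPat A → OPat A
  | .here s ch, .here s' ch' => .here (s ∪ s') (ch ++ ch')
  | .here s ch, .step s' ch' el rest => .step (s ∪ s') (ch ++ ch') el rest
  | .step s ch el rest, q => .step s ch el (OPat.comp rest q)

mutual
/-- The translation `ct` of CTP node formulas into Boolean conditional tree
patterns. -/
def ctN : CNF A → BPat A
  | .lab p => .mk {p} []
  | .top => .mk ∅ []
  | .and φ ψ => BPat.fuse (ctN φ) (ctN ψ)
  | .dia α φ => OPat.graft (ctP α) (ctN φ)
/-- The translation `ct` of CTP path formulas into conditional tree patterns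
with one output node. -/
def ctP : CPF A → OPat A
  | .child => .step ∅ [] none (.here ∅ [])
  | .test φ =>
      match ctN φ with
      | .mk s ch => .here s ch
  | .comp α β => OPat.comp (ctP α) (ctP β)
  | .cstar φ => .step ∅ [] (some (ctN φ)) (.here ∅ [])
end

structure Emb (S T : RTree A) (f : S.Node → T.Node) : Prop where
  inj : Function.Injective f
  lab : ∀ x, S.label x = T.label (f x)
  edge : ∀ x y, S.E x y ↔ T.E (f x) (f y)
  fwd : ∀ x y, T.E (f x) y → ∃ z, f z = y

theorem Emb.tg {S T : RTree A} {f : S.Node → T.Node} (h : Emb S T f) {x y : S.Node}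
    (hx : Relation.TransGen S.E x y) : Relation.TransGen T.E (f x) (f y) :=
  Relation.TransGen.lift f (fun a b hab => (h.edge a b).1 hab) _ _ hx

theorem Emb.lift_tg {S T : RTree A} {f : S.Node → T.Node} (h : Emb S T f) {x : S.Node} {y : T.Node}
    (hx : Relation.TransGen T.E (f x) y) : ∃ z, f z = y ∧ Relation.TransGen S.E x z := by
  induction hx with
  | single e =>
    obtain ⟨z, rfl⟩ := h.fwd _ _ e
    exact ⟨z, rfl, .single ((h.edge _ _).2 e)⟩
  | tail _ e ih =>
    obtain ⟨w, rfl, hw⟩ := ih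
    obtain ⟨z, rfl⟩ := h.fwd _ _ e
    exact ⟨z, rfl, hw.tail ((h.edge _ _).2 e)⟩

theorem Emb.tg_iff {S T : RTree A} {f : S.Node → T.Node} (h : Emb S T f) {x y : S.Node} :
    Relation.TransGen S.E x y ↔ Relation.TransGen T.E (f x) (f y) := by
  refine ⟨h.tg, fun hx => ?_⟩
  obtain ⟨z, hz, hxz⟩ := h.lift_tg hx
  rwa [← h.inj hz]

theorem Emb.sub {S T : RTree A} {f : S.Node → T.Node} (h : Emb S T f) (z : S.Node) :
    Emb (S.subtree z) (T.subtree (f z))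
      (fun m => ⟨f m.1, Relation.ReflTransGen.lift f (fun a b hab => (h.edge a b).1 hab) _ _ m.2⟩) where
  inj a b hab := Subtype.ext (h.inj (congrArg Subtype.val hab))
  lab x := h.lab x.1
  edge x y := h.edge x.1 y.1
  fwd x y e := by
    obtain ⟨w, hw⟩ := h.fwd x.1 y.1 e
    refine ⟨⟨w, x.2.tail ((h.edge _ _).2 ?_)⟩, Subtype.ext hw⟩
    rw [hw]; exact e

theorem emb_subtree (T : RTree A) (n : T.Node) : Emb (T.subtree n) T Subtype.val where
  inj := Subtype.val_injective
  lab _ := rfl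
  edge _ _ := Iff.rfl
  fwd x y e := ⟨⟨y, x.2.tail e⟩, rfl⟩

theorem Emb.cond {S T : RTree A} {f : S.Node → T.Node} (h : Emb S T f) (x m : S.Node)
    (P : S.Node → Prop) (Q : T.Node → Prop) (hPQ : ∀ z, P z ↔ Q (f z)) :
    (∀ z, Relation.TransGen S.E x z → Relation.TransGen S.E z m → P z) ↔
    (∀ z, Relation.TransGen T.E (f x) z → Relation.TransGen T.E z (f m) → Q z) := by
  constructor
  · intro H z h1 h2
    obtain ⟨w, rfl, hw⟩ := h.lift_tg h1
    exact (hPQ w).1 (H w hw (h.tg_iff.2 h2))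
  · intro H z h1 h2
    exact (hPQ z).2 (H _ (h.tg h1) (h.tg h2))

theorem Emb.ex_edge {S T : RTree A} {f : S.Node → T.Node} (h : Emb S T f) (x : S.Node)
    (P : S.Node → Prop) (Q : T.Node → Prop) (hPQ : ∀ z, P z ↔ Q (f z)) :
    (∃ m, S.E x m ∧ P m) ↔ (∃ m, T.E (f x) m ∧ Q m) := by
  constructor
  · rintro ⟨m, e, p⟩
    exact ⟨f m, (h.edge _ _).1 e, (hPQ m).1 p⟩
  · rintro ⟨m, e, p⟩
    obtain ⟨w, rfl⟩ := h.fwd _ _ e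
    exact ⟨w, (h.edge _ _).2 e, (hPQ w).2 p⟩

theorem Emb.ex_tg {S T : RTree A} {f : S.Node → T.Node} (h : Emb S T f) (x : S.Node)
    (P : S.Node → Prop) (Q : T.Node → Prop) (hPQ : ∀ z, P z ↔ Q (f z)) :
    (∃ m, Relation.TransGen S.E x m ∧ P m) ↔ (∃ m, Relation.TransGen T.E (f x) m ∧ Q m) := by
  constructor
  · rintro ⟨m, e, p⟩
    exact ⟨f m, h.tg e, (hPQ m).1 p⟩
  · rintro ⟨m, e, p⟩
    obtain ⟨w, rfl, hw⟩ := h.lift_tg e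
    exact ⟨w, hw, (hPQ w).2 p⟩

mutual
theorem simB_emb (p : BPat A) (S T : RTree A) (f : S.Node → T.Node) (h : Emb S T f) (x : S.Node) :
    SimB S p x ↔ SimB T p (f x) := by
  match p with
  | .mk s ch =>
    rw [SimB, SimB, h.lab x, simL_emb ch S T f h x]
termination_by sizeOf p
theorem simL_emb (l : List (Option (BPat A) × BPat A)) (S T : RTree A) (f : S.Node → T.Node)
    (h : Emb S T f) (x : S.Node) : SimL S l x ↔ SimL T l (f x) := by
  match l with
  | [] => rw [SimL, SimL]
  | (none, t) :: r =>
    rw [SimL, SimL, simL_emb r S T f h x]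
    refine and_congr_left fun _ => h.ex_edge _ _ _ fun z => simB_emb t S T f h z
  | (some c, t) :: r =>
    rw [SimL, SimL, simL_emb r S T f h x]
    refine and_congr_left fun _ => h.ex_tg _ _ _ fun z => and_congr (simB_emb t S T f h z) ?_
    exact h.cond x z _ (fun z => SimB (T.subtree z) c (T.subtree z).root)
      fun w => simB_emb c _ _ _ (h.sub w) _
termination_by sizeOf l
end

theorem simB_sub (T : RTree A) (p : BPat A) (n : T.Node) :
    SimB (T.subtree n) p (T.subtree n).root ↔ SimB T p n :=
  simB_emb p _ _ _ (emb_subtree T n) _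

theorem simO_emb (p : OPat A) (S T : RTree A) (f : S.Node → T.Node) (h : Emb S T f)
    (x o : S.Node) : SimO S p x o ↔ SimO T p (f x) (f o) := by
  induction p generalizing x with
  | here s ch => rw [SimO, SimO, h.lab x, simL_emb ch S T f h x, h.inj.eq_iff]
  | step s ch el rest ih =>
    rw [SimO.eq_def, SimO.eq_def]
    dsimp only
    rw [h.lab x, simL_emb ch S T f h x]
    refine and_congr_right fun _ => and_congr_right fun _ => ?_
    match el with
    | none => exact h.ex_edge _ _ _ fun z => ih z
    | some c =>
      refine h.ex_tg _ _ (fun m => SimO T rest m (f o) ∧ _) fun z => and_congr (ih z) ?_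
      exact h.cond x z _ (fun z => SimB (T.subtree z) c (T.subtree z).root)
        fun w => simB_emb c _ _ _ (h.sub w) _

theorem simO_reach (p : OPat A) (T : RTree A) (x o : T.Node) (h : SimO T p x o) :
    Relation.ReflTransGen T.E x o := by
  induction p generalizing x with
  | here s ch => rw [SimO] at h; rw [h.1]
  | step s ch el rest ih =>
    rw [SimO.eq_def] at h
    obtain ⟨-, -, h⟩ := h
    match el with
    | none => obtain ⟨m, e, h⟩ := h; exact .head e (ih m h)
    | some c => obtain ⟨m, e, h, -⟩ := h; exact e.to_reflTransGen.trans (ih m h)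

theorem simL_append (T : RTree A) (l r : List (Option (BPat A) × BPat A)) (n : T.Node) :
    SimL T (l ++ r) n ↔ SimL T l n ∧ SimL T r n := by
  induction l with
  | nil => simp [SimL]
  | cons a l ih =>
    obtain ⟨_ | c, t⟩ := a <;> simp only [List.cons_append, SimL, ih, and_assoc]

theorem simB_fuse (T : RTree A) (p q : BPat A) (n : T.Node) :
    SimB T (p.fuse q) n ↔ SimB T p n ∧ SimB T q n := by
  obtain ⟨s, ch⟩ := p
  obtain ⟨s', ch'⟩ := q
  simp only [BPat.fuse, SimB, simL_append, Set.union_subset_iff]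
  tauto

theorem simB_graft (T : RTree A) (p : OPat A) (b : BPat A) (n : T.Node) :
    SimB T (p.graft b) n ↔ ∃ m, SimO T p n m ∧ SimB T b m := by
  induction p generalizing n with
  | here s ch =>
    obtain ⟨s', ch'⟩ := b
    simp only [OPat.graft, SimB, SimO, simL_append, Set.union_subset_iff]
    constructor
    · rintro ⟨⟨h1, h2⟩, h3, h4⟩
      exact ⟨n, ⟨rfl, h1, h3⟩, h2, h4⟩
    · rintro ⟨m, ⟨rfl, h1, h3⟩, h2, h4⟩
      exact ⟨⟨h1, h2⟩, h3, h4⟩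
  | step s ch el rest ih =>
    cases el with
    | none =>
      simp only [OPat.graft, SimB, SimO, simL_append, SimL, ih]
      constructor
      · rintro ⟨h1, h2, ⟨m, e, o, h3, h4⟩, -⟩
        exact ⟨o, ⟨h1, h2, m, e, h3⟩, h4⟩
      · rintro ⟨o, ⟨h1, h2, m, e, h3⟩, h4⟩
        exact ⟨h1, h2, ⟨m, e, o, h3, h4⟩, trivial⟩
    | some c =>
      simp only [OPat.graft, SimB, SimO, simL_append, SimL, ih]
      constructor
      · rintro ⟨h1, h2, ⟨m, e, ⟨o, h3, h4⟩, h5⟩, -⟩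
        exact ⟨o, ⟨h1, h2, m, e, h3, h5⟩, h4⟩
      · rintro ⟨o, ⟨h1, h2, m, e, h3, h5⟩, h4⟩
        exact ⟨h1, h2, ⟨m, e, ⟨o, h3, h4⟩, h5⟩, trivial⟩

theorem simO_comp (T : RTree A) (p q : OPat A) (n o : T.Node) :
    SimO T (p.comp q) n o ↔ ∃ m, SimO T p n m ∧ SimO T q m o := by
  induction p generalizing n with
  | here s ch =>
    cases q with
    | here s' ch' =>
      simp only [OPat.comp, SimO, simL_append, Set.union_subset_iff]
      constructor
      · rintro ⟨h0, ⟨h1, h2⟩, h3, h4⟩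
        exact ⟨n, ⟨rfl, h1, h3⟩, h0, h2, h4⟩
      · rintro ⟨m, ⟨rfl, h1, h3⟩, h0, h2, h4⟩
        exact ⟨h0, ⟨h1, h2⟩, h3, h4⟩
    | step s' ch' el rest =>
      simp only [OPat.comp, SimO, simL_append, Set.union_subset_iff]
      constructor
      · rintro ⟨⟨h1, h2⟩, ⟨h3, h4⟩, h0⟩
        exact ⟨n, ⟨rfl, h1, h3⟩, h2, h4, h0⟩
      · rintro ⟨m, ⟨rfl, h1, h3⟩, h2, h4, h0⟩
        exact ⟨⟨h1, h2⟩, ⟨h3, h4⟩, h0⟩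
  | step s ch el rest ih =>
    cases el with
    | none =>
      simp only [OPat.comp, SimO, ih]
      constructor
      · rintro ⟨h1, h2, m, e, o, h3, h4⟩
        exact ⟨o, ⟨h1, h2, m, e, h3⟩, h4⟩
      · rintro ⟨o, ⟨h1, h2, m, e, h3⟩, h4⟩
        exact ⟨h1, h2, m, e, o, h3, h4⟩
    | some c =>
      simp only [OPat.comp, SimO, ih]
      constructor
      · rintro ⟨h1, h2, m, e, ⟨o, h3, h4⟩, h5⟩
        exact ⟨o, ⟨h1, h2, m, e, h3, h5⟩, h4⟩
      · rintro ⟨o, ⟨h1, h2, m, e, h3, h5⟩, h4⟩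
        exact ⟨h1, h2, m, e, ⟨o, h3, h4⟩, h5⟩

theorem cstar_iff (T : RTree A) (hT : T.IsPreTree) (P : T.Node → Prop) (n m : T.Node) :
    (∃ k, Relation.ReflTransGen (fun a b => T.E a b ∧ P b) n k ∧ T.E k m) ↔
    (Relation.TransGen T.E n m ∧
      ∀ z, Relation.TransGen T.E n z → Relation.TransGen T.E z m → P z) := by
  obtain ⟨-, -, hpar, hac⟩ := hT
  constructor
  · rintro ⟨k, hk, e⟩
    have h1 : Relation.ReflTransGen T.E n k := Relation.ReflTransGen.mono (fun a b h => h.1) _ _ hk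
    refine ⟨.tail' h1 e, fun z hz hzm => ?_⟩
    have h2 : Relation.ReflTransGen T.E z k := by
      obtain ⟨k', hk', e'⟩ := Relation.TransGen.tail'_iff.1 hzm
      rwa [hpar _ _ _ e e']
    clear e h1 hzm
    induction hk with
    | refl => exact absurd (hz.trans_left h2) (hac n)
    | tail _ e ih =>
      rcases Relation.ReflTransGen.cases_tail h2 with h | ⟨c, hc, e'⟩
      · rw [← h]; exact e.2
      · apply ih
        rwa [hpar _ _ _ e.1 e']
  · rintro ⟨h, H⟩
    obtain ⟨k, hk, e⟩ := Relation.TransGen.tail'_iff.1 h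
    refine ⟨k, ?_, e⟩
    have H' : ∀ z, Relation.TransGen T.E n z → Relation.ReflTransGen T.E z k → P z :=
      fun z h1 h2 => H z h1 (.tail' h2 e)
    clear h H e
    induction hk with
    | refl => exact .refl
    | tail h e ih =>
      exact .tail (ih fun z h1 h2 => H' z h1 (h2.tail e)) ⟨e, H' _ (.tail' h e) .refl⟩

mutual
theorem sat_iff (T : RTree A) (hT : T.IsPreTree) (φ : CNF A) (n : T.Node) :
    n ∈ CNF.sat T φ ↔ SimB T (ctN φ) n := by
  match φ with
  | .lab p => simp [CNF.sat, ctN, SimB, SimL]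
  | .top => simp [CNF.sat, ctN, SimB, SimL]
  | .and φ ψ =>
    rw [ctN, simB_fuse, ← sat_iff T hT φ n, ← sat_iff T hT ψ n, CNF.sat]; rfl
  | .dia α φ =>
    rw [ctN, simB_graft, CNF.sat]
    exact exists_congr fun m => and_congr (sem_iff T hT α n m) (sat_iff T hT φ m)
termination_by sizeOf φ
theorem sem_iff (T : RTree A) (hT : T.IsPreTree) (α : CPF A) (n m : T.Node) :
    CPF.sem T α n m ↔ SimO T (ctP α) n m := by
  match α with
  | .child => simp [CPF.sem, ctP, SimO, SimL]
  | .test φ =>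
    have h := sat_iff T hT φ n
    rw [ctP, CPF.sem]; dsimp only; rw [h]
    cases ctN φ with
    | mk s ch => simp only [SimO, SimB, eq_comm]
  | .comp α β =>
    rw [ctP, simO_comp, CPF.sem]
    exact exists_congr fun k => and_congr (sem_iff T hT α n k) (sem_iff T hT β k m)
  | .cstar φ =>
    rw [CPF.sem]; dsimp only; rw [cstar_iff T hT (fun b => b ∈ CNF.sat T φ)]
    have h := fun z => sat_iff T hT φ z
    simp [ctP, SimO, SimL, simB_sub, h]
termination_by sizeOf α
end

/-- the simulation characterization for CTP node and path formulas
also holds over possibly infinite trees (trees whose node set need not be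
finite, but whose label sets are finite and which satisfy the remaining tree
axioms). -/
theorem ctp_simulation_infinite (T : RTree A) (hT : T.IsPreTree) :
    (∀ (φ : CNF A) (n : T.Node),
      n ∈ CNF.sat T φ ↔ SimB (T.subtree n) (ctN φ) (T.subtree n).root) ∧
    (∀ (α : CPF A) (n n' : T.Node),
      CPF.sem T α n n' ↔
        ∃ h : Relation.ReflTransGen T.E n n',
          SimO (T.subtree n) (ctP α) (T.subtree n).root ⟨n', h⟩) := by
  refine ⟨fun φ n => ?_, fun α n n' => ?_⟩
  · rw [simB_sub]
    exact sat_iff T hT φ n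
  · rw [sem_iff T hT α n n']
    constructor
    · intro h
      exact ⟨simO_reach _ _ _ _ h, (simO_emb _ _ _ _ (emb_subtree T n) _ _).2 h⟩
    · rintro ⟨h, h'⟩
      exact (simO_emb _ _ _ _ (emb_subtree T n) _ _).1 h'
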